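/- Let 0 < β′ < β and E ∈ [0, β′). If the distance from E to the set σ(H) is strictly greater than (β′)² ‖HΠ‖² β⁻³, then H̃ − E is invertible in 𝓛(Πℋ); in other words, E ∉ σ(H̃). -/

import Mathlib

noncomputable section

open MeasureTheory
open scoped ComplexOrder

/-- The abstract Feshbach–Schur setup: a densely defined nonnegative self-adjoint operator `H`,
an orthogonal projection `P` (denoted `Π`) with range in the domain of `H`, a bounded operator
`T = HΠ`, and a lower bound `Π⊥ H Π⊥ ≥ 2β Π⊥`. -/
structure FeshbachSetup (ℋ : Type*) [NormedAddCommGroup ℋ] [InnerProductSpace ℂ ℋ]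
    [CompleteSpace ℋ] (β : ℝ) : Type _ where
  H : ℋ →ₗ.[ℂ] ℋ
  dense_dom : Dense (H.domain : Set ℋ)
  selfAdjoint : IsSelfAdjoint H
  nonneg : ∀ u : H.domain, 0 ≤ (inner ℂ (u : ℋ) (H u) : ℂ)
  P : ℋ →L[ℂ] ℋ
  P_idem : P.comp P = P
  P_sa : ContinuousLinearMap.adjoint P = P
  memP : ∀ x : ℋ, P x ∈ H.domain
  T : ℋ →L[ℂ] ℋ
  T_eq : ∀ x : ℋ, T x = H ⟨P x, memP x⟩
  β_pos : 0 < β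
  lower : ∀ u : H.domain,
    ((2 * β * ‖(u : ℋ) - P u‖ ^ 2 : ℝ) : ℂ) ≤
      inner ℂ ((u : ℋ) - P u) (H ⟨(u : ℋ) - P u, H.domain.sub_mem u.2 (memP u)⟩)

namespace FeshbachSetup

variable {ℋ : Type*} [NormedAddCommGroup ℋ] [InnerProductSpace ℂ ℋ] [CompleteSpace ℋ]
variable {β : ℝ} (S : FeshbachSetup ℋ β)

/-- `R` witnesses that `H - E` is a bijection from the domain of `H` onto `ℋ`
with bounded inverse `R`. -/
def IsInvWitness (E : ℝ) (R : ℋ →L[ℂ] ℋ) : Prop :=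
  (∀ u : S.H.domain, R (S.H u - (E : ℂ) • (u : ℋ)) = u) ∧
  (∀ y : ℋ, ∃ h : R y ∈ S.H.domain, S.H ⟨R y, h⟩ - (E : ℂ) • R y = y)

/-- `H - E` is a bijection from the domain of `H` onto `ℋ` with bounded inverse. -/
def IsInvertibleAt (E : ℝ) : Prop := ∃ R, S.IsInvWitness E R

/-- the spectrum `σ(H)` (as a subset of `ℝ`). -/
def spec : Set ℝ := {E | ¬ S.IsInvertibleAt E}

/-- the bounded operator `Π⊥ H Π`. -/
def A : ℋ →L[ℂ] ℋ := (1 - S.P).comp S.T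

/-- `R : ℝ → 𝓛(ℋ)` is the family of reduced resolvents `E ↦ R⊥(E)`:  for `E ∈ [0, 2β)`,
`R E` is supported on `Π⊥ℋ` and is there a two-sided inverse of `Π⊥(H - E)Π⊥`. -/
def IsRedResolvent (R : ℝ → (ℋ →L[ℂ] ℋ)) : Prop :=
  ∀ E ∈ Set.Ico (0 : ℝ) (2 * β),
    ((1 - S.P).comp ((R E).comp (1 - S.P)) = R E) ∧
    (∀ u : S.H.domain,
      R E ((1 - S.P)
          (S.H ⟨(u : ℋ) - S.P u, S.H.domain.sub_mem u.2 (S.memP u)⟩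
            - (E : ℂ) • ((u : ℋ) - S.P u)))
        = (u : ℋ) - S.P u) ∧
    (∀ y : ℋ, ∃ h : R E y ∈ S.H.domain,
      (1 - S.P) (S.H ⟨R E y, h⟩ - (E : ℂ) • R E y) = (1 - S.P) y)

/-- `Y = Π + ΠHΠ⊥ R⊥(0)² Π⊥HΠ`, as an operator on `ℋ` vanishing on `Π⊥ℋ`. -/
def Y (R : ℝ → (ℋ →L[ℂ] ℋ)) : ℋ →L[ℂ] ℋ :=
  S.P + (ContinuousLinearMap.adjoint S.A).comp ((R 0).comp ((R 0).comp S.A))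

/-- `G` is `Y^{-1/2} ∈ 𝓛(Πℋ)`, extended by `0` on `Π⊥ℋ`:  `G` is supported on `Πℋ`,
self-adjoint, nonnegative, and `G Y G = Π`. -/
def IsYInvSqrt (R : ℝ → (ℋ →L[ℂ] ℋ)) (G : ℋ →L[ℂ] ℋ) : Prop :=
  S.P.comp (G.comp S.P) = G ∧
  ContinuousLinearMap.adjoint G = G ∧
  (∀ x : ℋ, 0 ≤ (inner ℂ x (G x) : ℂ)) ∧
  G.comp ((S.Y R).comp G) = S.P

/-- the dressed operator `H̃ = Y^{-1/2}[ΠHΠ - ΠHΠ⊥R⊥(0)Π⊥HΠ]Y^{-1/2}`,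
extended by `0` on `Π⊥ℋ`. -/
def Htilde (R : ℝ → (ℋ →L[ℂ] ℋ)) (G : ℋ →L[ℂ] ℋ) : ℋ →L[ℂ] ℋ :=
  G.comp (((S.P.comp S.T) - (ContinuousLinearMap.adjoint S.A).comp ((R 0).comp S.A)).comp G)

end FeshbachSetup

/-- `V` is a two-sided inverse of `W` in the corner algebra `Π 𝓛(ℋ) Π` (with unit `P`),
i.e. `W` viewed as an operator on `Πℋ` is invertible with inverse `V`. -/
def IsCornerInv {ℋ : Type*} [NormedAddCommGroup ℋ] [InnerProductSpace ℂ ℋ]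
    (P W V : ℋ →L[ℂ] ℋ) : Prop :=
  P.comp (V.comp P) = V ∧ V.comp W = P ∧ W.comp V = P

/-- the spectrum of an operator `W` supported on `Πℋ`, viewed as a bounded operator
on `Πℋ` (as a subset of `ℝ`). -/
def cornerSpec {ℋ : Type*} [NormedAddCommGroup ℋ] [InnerProductSpace ℂ ℋ]
    (P W : ℋ →L[ℂ] ℋ) : Set ℝ :=
  {E : ℝ | ¬ ∃ V, IsCornerInv P (W - (E : ℂ) • P) V}

namespace FeshbachSetup

variable {ℋ : Type*} [NormedAddCommGroup ℋ] [InnerProductSpace ℂ ℋ] [CompleteSpace ℋ]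
variable {β : ℝ} (S : FeshbachSetup ℋ β)

lemma PP (x : ℋ) : S.P (S.P x) = S.P x := congrArg (fun f => f x) S.P_idem

lemma P_inner (x y : ℋ) : (inner ℂ (S.P x) y : ℂ) = inner ℂ x (S.P y) := by
  conv_lhs => rw [← S.P_sa]
  exact ContinuousLinearMap.adjoint_inner_left _ _ _

lemma graph_mk {u : ℋ} (h : u ∈ S.H.domain) : (u, S.H ⟨u, h⟩) ∈ S.H.graph :=
  S.H.mem_graph ⟨u, h⟩

lemma graph_dest {u w : ℋ} (h : (u, w) ∈ S.H.graph) :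
    ∃ hu : u ∈ S.H.domain, S.H ⟨u, hu⟩ = w := by
  rw [LinearPMap.mem_graph_iff] at h
  obtain ⟨y, hy, hw⟩ := h
  simp only at hy hw
  subst hy
  exact ⟨y.2, hw⟩

lemma graph_symm {u w u' w' : ℋ} (h : (u, w) ∈ S.H.graph) (h' : (u', w') ∈ S.H.graph) :
    (inner ℂ w u' : ℂ) = inner ℂ u w' := by
  obtain ⟨hu, rfl⟩ := S.graph_dest h
  obtain ⟨hu', rfl⟩ := S.graph_dest h'
  have := LinearPMap.adjoint_isFormalAdjoint (T := S.H) S.dense_dom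
  rw [LinearPMap.isSelfAdjoint_def.1 S.selfAdjoint] at this
  exact this ⟨u, hu⟩ ⟨u', hu'⟩

lemma graph_T (x : ℋ) : (S.P x, S.T x) ∈ S.H.graph := by
  rw [S.T_eq]; exact S.graph_mk _

lemma T_P (x : ℋ) : S.T (S.P x) = S.T x := by
  rw [S.T_eq, S.T_eq]; congr 2; exact S.PP x

lemma graph_lower {u w : ℋ} (h : (u, w) ∈ S.H.graph) (hP : S.P u = 0) :
    2 * β * ‖u‖ ^ 2 ≤ (inner ℂ u w : ℂ).re := by
  obtain ⟨hu, rfl⟩ := S.graph_dest h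
  have := (Complex.le_def.1 (S.lower ⟨u, hu⟩)).1
  simp only [hP, sub_zero, Complex.ofReal_re] at this
  exact this

lemma inv1 {E : ℝ} {Rh : ℋ →L[ℂ] ℋ} (hRh : S.IsInvWitness E Rh) {u w : ℋ}
    (h : (u, w) ∈ S.H.graph) : Rh (w - (E : ℂ) • u) = u := by
  obtain ⟨hu, rfl⟩ := S.graph_dest h
  exact hRh.1 ⟨u, hu⟩

lemma inv2 {E : ℝ} {Rh : ℋ →L[ℂ] ℋ} (hRh : S.IsInvWitness E Rh) (y : ℋ) :
    (Rh y, y + (E : ℂ) • Rh y) ∈ S.H.graph := by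
  obtain ⟨h, e⟩ := hRh.2 y
  rw [← sub_eq_iff_eq_add.1 e]
  exact S.graph_mk h

lemma red_P {R : ℝ → (ℋ →L[ℂ] ℋ)} (hR : S.IsRedResolvent R) {E : ℝ}
    (hE : E ∈ Set.Ico (0 : ℝ) (2 * β)) (y : ℋ) : S.P (R E y) = 0 := by
  rw [← (hR E hE).1]; simp [S.PP]

lemma red_P' {R : ℝ → (ℋ →L[ℂ] ℋ)} (hR : S.IsRedResolvent R) {E : ℝ}
    (hE : E ∈ Set.Ico (0 : ℝ) (2 * β)) (y : ℋ) : R E (S.P y) = 0 := by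
  rw [← (hR E hE).1]; simp [S.PP]

lemma red1 {R : ℝ → (ℋ →L[ℂ] ℋ)} (hR : S.IsRedResolvent R) {E : ℝ}
    (hE : E ∈ Set.Ico (0 : ℝ) (2 * β)) {u w : ℋ} (h : (u, w) ∈ S.H.graph) (hP : S.P u = 0) :
    R E (w - (E : ℂ) • u) = u := by
  obtain ⟨hu, rfl⟩ := S.graph_dest h
  have := (hR E hE).2.1 ⟨u, hu⟩
  simpa [hP, S.red_P' hR hE] using this

lemma red2 {R : ℝ → (ℋ →L[ℂ] ℋ)} (hR : S.IsRedResolvent R) {E : ℝ}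
    (hE : E ∈ Set.Ico (0 : ℝ) (2 * β)) (y : ℋ) :
    ∃ w, (R E y, w) ∈ S.H.graph ∧ w - S.P w - (E : ℂ) • R E y = y - S.P y := by
  obtain ⟨h, e⟩ := (hR E hE).2.2 y
  refine ⟨_, S.graph_mk h, ?_⟩
  simp [S.red_P hR hE] at e
  rw [← e]; abel

lemma red_norm {R : ℝ → (ℋ →L[ℂ] ℋ)} (hR : S.IsRedResolvent R) {E : ℝ}
    (hE : E ∈ Set.Ico (0 : ℝ) (2 * β)) : ‖R E‖ ≤ (2 * β - E)⁻¹ := by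
  have hpos : 0 < 2 * β - E := by linarith [hE.2]
  refine ContinuousLinearMap.opNorm_le_bound _ (by positivity) fun y => ?_
  obtain ⟨w, hw, e⟩ := S.red2 hR hE y
  have hP := S.red_P hR hE y
  have h1 := S.graph_lower hw hP
  have hr : w = y - S.P y + (E : ℂ) • R E y + S.P w := by rw [← e]; abel
  have h2 : (inner ℂ (R E y) w : ℂ) = inner ℂ (R E y) y + E * (‖R E y‖ : ℂ) ^ 2 := by
    rw [hr]
    simp only [inner_add_right, inner_sub_right, inner_smul_right, ← S.P_inner, hP,
      inner_zero_left, inner_self_eq_norm_sq_to_K]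
    simp
  rw [h2] at h1
  have h3 : ((inner ℂ (R E y) y : ℂ) + E * (‖R E y‖ : ℂ) ^ 2).re
      = (inner ℂ (R E y) y : ℂ).re + E * ‖R E y‖ ^ 2 := by
    rw [Complex.add_re]; congr 1; norm_cast
  rw [h3] at h1
  have h4 : (inner ℂ (R E y) y : ℂ).re ≤ ‖R E y‖ * ‖y‖ := re_inner_le_norm (𝕜 := ℂ) _ _
  rw [inv_mul_eq_div, le_div_iff₀ hpos]
  rcases (norm_nonneg (R E y)).eq_or_lt with h0 | h0
  · rw [← h0]; simp
  · have : ‖R E y‖ * (‖R E y‖ * (2 * β - E)) ≤ ‖R E y‖ * ‖y‖ := by nlinarith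
    exact le_of_mul_le_mul_left this h0

lemma red_resolvent {R : ℝ → (ℋ →L[ℂ] ℋ)} (hR : S.IsRedResolvent R) {E : ℝ}
    (hE : E ∈ Set.Ico (0 : ℝ) (2 * β)) (y : ℋ) :
    R E y = R 0 y + (E : ℂ) • R 0 (R E y) := by
  have h0 : (0 : ℝ) ∈ Set.Ico (0 : ℝ) (2 * β) := ⟨le_rfl, by linarith [S.β_pos]⟩
  obtain ⟨w, hw, e⟩ := S.red2 hR hE y
  have h1 := S.red1 hR h0 hw (S.red_P hR hE y)
  have hr : w = y - S.P y + (E : ℂ) • R E y + S.P w := by rw [← e]; abel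
  rw [hr] at h1
  simp [S.red_P' hR h0] at h1
  exact h1.symm

lemma inv_resolvent {E E' : ℝ} {Q Q' : ℋ →L[ℂ] ℋ} (h : S.IsInvWitness E Q)
    (h' : S.IsInvWitness E' Q') (y : ℋ) : Q' y = Q y + ((E' : ℂ) - E) • Q (Q' y) := by
  have := S.inv1 h (S.inv2 h' y)
  conv_lhs => rw [← this]
  simp only [map_add, map_sub, map_smul]
  module

lemma inv_selfAdjoint {E : ℝ} {Q : ℋ →L[ℂ] ℋ} (h : S.IsInvWitness E Q) :
    IsSelfAdjoint Q := by
  rw [ContinuousLinearMap.isSelfAdjoint_iff_isSymmetric]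
  intro x y
  have := S.graph_symm (S.inv2 h x) (S.inv2 h y)
  simpa [inner_add_left, inner_add_right, inner_smul_left, inner_smul_right] using this.symm

lemma inv_norm {E : ℝ} {Q : ℋ →L[ℂ] ℋ} (h : S.IsInvWitness E Q) :
    ‖Q‖ * Metric.infDist E S.spec ≤ 1 := by
  rcases subsingleton_or_nontrivial ℋ with _ | _
  · have : Q = 0 := Subsingleton.elim _ _
    simp [this]
  have hsa := S.inv_selfAdjoint h
  obtain ⟨z, hz, hzn⟩ := spectrum.exists_nnnorm_eq_spectralRadius Q
  rw [hsa.spectralRadius_eq_nnnorm] at hzn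
  have hn : ‖z‖ = ‖Q‖ := by
    have : ‖z‖₊ = ‖Q‖₊ := by exact_mod_cast hzn
    exact congrArg NNReal.toReal this
  have hre := hsa.mem_spectrum_eq_re hz
  set t : ℝ := z.re
  rcases eq_or_ne t 0 with h0 | h0
  · rw [← hn, hre, h0]; simp
  have hmem : E + t⁻¹ ∈ S.spec := by
    rintro ⟨Q', h'⟩
    apply spectrum.mem_iff.1 hz
    rw [hre]
    have htc : (t : ℂ) ≠ 0 := by exact_mod_cast h0
    have e1 : ∀ y, Q' y = Q y + (t : ℂ)⁻¹ • Q (Q' y) := fun y => by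
      have := S.inv_resolvent h h' y
      push_cast at this
      rwa [add_sub_cancel_left] at this
    have e2 : ∀ y, Q y = Q' y - (t : ℂ)⁻¹ • Q' (Q y) := fun y => by
      have := S.inv_resolvent h' h y
      push_cast at this
      rwa [sub_add_cancel_left, neg_smul, ← sub_eq_add_neg] at this
    refine ⟨⟨_, (t : ℂ)⁻¹ • (1 + (t : ℂ)⁻¹ • Q'), ?_, ?_⟩, rfl⟩
    · ext y
      have := e1 y
      simp only [Algebra.algebraMap_eq_smul_one, mul_apply_eq_comp,
        sub_apply, smul_apply, add_apply,
        one_apply_eq_self, map_add, map_smul, smul_add, smul_smul] at *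
      simp only [smul_sub, smul_smul, mul_assoc, inv_mul_cancel₀ htc, mul_one, one_smul]
      linear_combination (norm := module) (t : ℂ)⁻¹ • this
    · ext y
      have := e2 y
      simp only [Algebra.algebraMap_eq_smul_one, mul_apply_eq_comp,
        sub_apply, smul_apply, add_apply,
        one_apply_eq_self, map_sub, map_smul, smul_add, smul_sub, smul_smul] at *
      rw [mul_inv_cancel₀ htc, mul_inv_cancel_left₀ htc, one_smul]
      linear_combination (norm := module) (-(t : ℂ)⁻¹) • this
  have hd := Metric.infDist_le_dist_of_mem (x := E) hmem
  have hd' : dist E (E + t⁻¹) = |t|⁻¹ := by simp [Real.dist_eq]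
  have hQ : ‖Q‖ = |t| := by rw [← hn, hre]; simp
  rw [hd'] at hd
  rw [hQ]
  have hp : 0 < |t| := abs_pos.2 h0
  calc |t| * _ ≤ |t| * |t|⁻¹ := by gcongr
    _ = 1 := mul_inv_cancel₀ hp.ne'

/-- The Feshbach map. -/
def Fesh (R : ℝ → (ℋ →L[ℂ] ℋ)) (E : ℝ) : ℋ →L[ℂ] ℋ :=
  S.P * S.T - (E : ℂ) • S.P - ContinuousLinearMap.adjoint S.A * (R E * S.A)

lemma P_graph {u w : ℋ} (h : (u, w) ∈ S.H.graph) (hP : S.P u = 0) :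
    S.P w = ContinuousLinearMap.adjoint S.A u := by
  refine ext_inner_left ℂ fun x => ?_
  rw [ContinuousLinearMap.adjoint_inner_right, ← S.P_inner, ← S.graph_symm (S.graph_T x) h]
  simp [A, inner_sub_left, S.P_inner, hP]

lemma A_P : S.A * S.P = S.A := by
  ext x; simp [A, S.T_P]

lemma P_A : S.P * S.A = 0 := by
  ext x; simp [A, S.PP]

lemma P_adjA : S.P * ContinuousLinearMap.adjoint S.A = ContinuousLinearMap.adjoint S.A := by
  have := congrArg star S.A_P
  rw [star_mul] at this
  simpa [ContinuousLinearMap.star_eq_adjoint, S.P_sa] using this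

lemma Fesh_P (R : ℝ → (ℋ →L[ℂ] ℋ)) (E : ℝ) : S.Fesh R E * S.P = S.Fesh R E := by
  have h1 : S.T * S.P = S.T := by ext x; exact S.T_P x
  have h2 : S.P * S.P = S.P := S.P_idem
  simp only [Fesh, sub_mul, mul_assoc, smul_mul_assoc, h1, h2, S.A_P]

lemma P_Fesh (R : ℝ → (ℋ →L[ℂ] ℋ)) (E : ℝ) : S.P * S.Fesh R E = S.Fesh R E := by
  have h2 : S.P * S.P = S.P := S.P_idem
  simp only [Fesh, mul_sub, ← mul_assoc, mul_smul_comm, h2, S.P_adjA]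

lemma inv_Fesh {R : ℝ → (ℋ →L[ℂ] ℋ)} (hR : S.IsRedResolvent R) {E : ℝ}
    (hE : E ∈ Set.Ico (0 : ℝ) (2 * β)) {Q : ℋ →L[ℂ] ℋ} (h : S.IsInvWitness E Q) :
    (S.P * Q * S.P) * S.Fesh R E = S.P := by
  rw [mul_assoc, S.P_Fesh]
  ext x
  obtain ⟨w, hw, e⟩ := S.red2 hR hE (S.A x)
  have hP := S.red_P hR hE (S.A x)
  have hg := S.H.graph.sub_mem (S.graph_T x) hw
  have hi := S.inv1 h (u := S.P x - R E (S.A x)) (w := S.T x - w) hg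
  have hPA : S.P (S.A x) = 0 := congrArg (fun f => f x) S.P_A
  have key : S.T x - w - (E : ℂ) • (S.P x - R E (S.A x)) = S.Fesh R E x := by
    have hPw := S.P_graph hw hP
    have hA : S.A x = S.T x - S.P (S.T x) := by simp [A]
    rw [hPA, sub_zero] at e
    have hr : w = S.T x - S.P (S.T x) + (E : ℂ) • R E (S.A x) + S.P w := by
      rw [← hA]; nth_rewrite 1 [← e]; abel
    have hF : S.Fesh R E x = S.P (S.T x) - (E : ℂ) • S.P x - S.P w := by
      rw [hPw]; simp [Fesh]
    rw [hF]
    nth_rewrite 1 [hr]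
    rw [smul_sub]
    abel
  rw [key] at hi
  simp [hi, S.PP, hP]

lemma Fesh_inv {R : ℝ → (ℋ →L[ℂ] ℋ)} (hR : S.IsRedResolvent R) {E : ℝ}
    (hE : E ∈ Set.Ico (0 : ℝ) (2 * β)) {Q : ℋ →L[ℂ] ℋ} (h : S.IsInvWitness E Q) :
    S.Fesh R E * (S.P * Q * S.P) = S.P := by
  rw [← mul_assoc, ← mul_assoc, S.Fesh_P]
  ext y
  simp only [mul_apply_eq_comp]
  have hv := S.inv2 h (S.P y)
  set v := Q (S.P y)
  have hq : (v - S.P v, S.P y + (E : ℂ) • v - S.T v) ∈ S.H.graph :=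
    S.H.graph.sub_mem hv (S.graph_T v)
  have hP : S.P (v - S.P v) = 0 := by simp [S.PP]
  have h1 := S.red1 hR hE hq hP
  have h2 := S.P_graph hq hP
  have hA : S.A v = S.T v - S.P (S.T v) := by simp [A]
  have h3 : v - S.P v = - R E (S.A v) := by
    rw [hA]
    rw [← h1]
    simp [S.red_P' hR hE]
  rw [h3] at h2
  simp only [map_sub, map_add, map_smul, S.PP, map_neg] at h2
  have hF : S.Fesh R E v = S.P (S.T v) - (E : ℂ) • S.P v
    + - ContinuousLinearMap.adjoint S.A (R E (S.A v)) := by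
      simp [Fesh, sub_eq_add_neg]
  rw [hF, ← h2]
  abel

end FeshbachSetup

lemma corner_perturb {𝒜 : Type*} [NormedRing 𝒜] [CompleteSpace 𝒜] {P F Q B : 𝒜}
    (hPQ : P * Q = Q) (hQP : Q * P = Q) (hFP : F * P = F)
    (hPB : P * B = B) (hBP : B * P = B) (hQF : Q * F = P) (hFQ : F * Q = P)
    (hn : ‖Q * B‖ < 1) :
    ∃ K, P * K = K ∧ K * P = K ∧ K * (F + B) = P ∧ (F + B) * K = P := by
  let u : 𝒜ˣ := Units.oneSub (-(Q * B)) (by rwa [norm_neg])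
  have hu : (u : 𝒜) = 1 + Q * B := by simp [u]
  have e1 : (1 + Q * B) * (↑u⁻¹ * Q) = Q := by rw [← hu, ← mul_assoc, u.mul_inv, one_mul]
  have e2 : (↑u⁻¹ : 𝒜) * (1 + Q * B) = 1 := by rw [← hu, u.inv_mul]
  refine ⟨↑u⁻¹ * Q, ?_, by rw [mul_assoc, hQP], ?_, ?_⟩
  · have : ↑u⁻¹ * Q = Q - Q * B * (↑u⁻¹ * Q) := by
      rw [eq_sub_iff_add_eq, ← one_add_mul, e1]
    rw [this, mul_sub, ← mul_assoc, ← mul_assoc P Q B, hPQ]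
  · rw [mul_assoc, mul_add, hQF]
    have : P + Q * B = (1 + Q * B) * P := by rw [add_mul, one_mul, mul_assoc, hBP]
    rw [this, ← mul_assoc, e2, one_mul]
  · have : F + B = F * (1 + Q * B) := by
      rw [mul_add, mul_one, ← mul_assoc, hFQ, hPB]
    rw [this, mul_assoc, e1, hFQ]

/-- Let `0 < β' < β` and `E ∈ [0, β')`.  If the distance from `E` to `σ(H)` is strictly
greater than `(β')² ‖HΠ‖² β⁻³`, then `H̃ - E` is invertible in `𝓛(Πℋ)`, i.e. `E ∉ σ(H̃)`. -/
theorem not_mem_cornerSpec_of_infDist_lt {ℋ : Type*} [NormedAddCommGroup ℋ]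
    [InnerProductSpace ℂ ℋ] [CompleteSpace ℋ] {β : ℝ} (S : FeshbachSetup ℋ β)
    (R : ℝ → (ℋ →L[ℂ] ℋ)) (hR : S.IsRedResolvent R)
    (G : ℋ →L[ℂ] ℋ) (hG : S.IsYInvSqrt R G)
    {β' E : ℝ} (hβ'0 : 0 < β') (hβ' : β' < β) (hE : E ∈ Set.Ico 0 β')
    (hdist : β' ^ 2 * ‖S.T‖ ^ 2 * (β ^ 3)⁻¹ < Metric.infDist E S.spec) :
    E ∉ cornerSpec S.P (S.Htilde R G) := by
  intro hmem
  apply hmem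
  have hβ := S.β_pos
  obtain ⟨hE0, hE1⟩ := hE
  have hEI : E ∈ Set.Ico (0 : ℝ) (2 * β) := ⟨hE0, by linarith⟩
  have h0I : (0 : ℝ) ∈ Set.Ico (0 : ℝ) (2 * β) := ⟨le_rfl, by linarith⟩
  set d := Metric.infDist E S.spec with hd
  have hdpos : 0 < d := lt_of_le_of_lt (by positivity) hdist
  have hinv : S.IsInvertibleAt E := by
    by_contra hcon
    have : E ∈ S.spec := hcon
    rw [hd, Metric.infDist_zero_of_mem this] at hdpos
    exact lt_irrefl _ hdpos
  obtain ⟨Rh, hRh⟩ := hinv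
  have hPP : S.P * S.P = S.P := S.P_idem
  have hPn : ‖S.P‖ ≤ 1 := by
    refine ContinuousLinearMap.opNorm_le_bound _ zero_le_one fun x => ?_
    have h1 : (inner ℂ (S.P x) (S.P x) : ℂ) = inner ℂ (S.P x) x := by
      rw [S.P_inner, S.PP, S.P_inner]
    have h2 : ‖S.P x‖ ^ 2 ≤ ‖S.P x‖ * ‖x‖ := by
      rw [← inner_self_eq_norm_sq (𝕜 := ℂ), h1]
      exact re_inner_le_norm _ _
    rcases (norm_nonneg (S.P x)).eq_or_lt with h0 | h0
    · rw [← h0]; positivity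
    · rw [one_mul]; rw [sq] at h2; exact le_of_mul_le_mul_left h2 h0
  have hAn : ‖S.A‖ ≤ ‖S.T‖ := by
    refine ContinuousLinearMap.opNorm_le_bound _ (norm_nonneg _) fun x => ?_
    refine le_trans ?_ (S.T.le_opNorm x)
    have hA : S.A x = S.T x - S.P (S.T x) := by simp [FeshbachSetup.A]
    generalize S.T x = y at hA
    have h1 : (inner ℂ (S.A x) (S.A x) : ℂ) = inner ℂ (S.A x) y := by
      have hPa : S.P (S.A x) = 0 := by rw [hA]; simp [S.PP]
      nth_rewrite 2 [hA]
      rw [inner_sub_right, ← S.P_inner, hPa]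
      simp
    have h2 : ‖S.A x‖ ^ 2 ≤ ‖S.A x‖ * ‖y‖ := by
      rw [← inner_self_eq_norm_sq (𝕜 := ℂ), h1]
      exact re_inner_le_norm _ _
    rcases (norm_nonneg (S.A x)).eq_or_lt with h0 | h0
    · rw [← h0]; positivity
    · rw [sq] at h2; exact le_of_mul_le_mul_left h2 h0
  set A' := ContinuousLinearMap.adjoint S.A with hA'
  have hA'n : ‖A'‖ ≤ ‖S.T‖ := by
    rw [hA', LinearIsometryEquiv.norm_map]; exact hAn
  let Q := S.P * Rh * S.P
  let B := ((E : ℂ) ^ 2) • (A' * (R 0 * (R 0 * (R E * S.A))))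
  have hQn : ‖Q‖ * d ≤ 1 := by
    refine le_trans ?_ (S.inv_norm hRh)
    gcongr
    calc ‖S.P * Rh * S.P‖ ≤ ‖S.P‖ * ‖Rh‖ * ‖S.P‖ := norm_mul₃_le
      _ ≤ 1 * ‖Rh‖ * 1 := by gcongr
      _ = ‖Rh‖ := by ring
  have hR0 : ‖R 0‖ ≤ β⁻¹ := by
    refine (S.red_norm hR h0I).trans ?_
    gcongr; linarith
  have hRE : ‖R E‖ ≤ β⁻¹ := by
    refine (S.red_norm hR hEI).trans ?_
    gcongr; linarith
  have hBn : ‖B‖ < d := by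
    refine lt_of_le_of_lt ?_ hdist
    calc ‖B‖ = E ^ 2 * ‖A' * (R 0 * (R 0 * (R E * S.A)))‖ := by
          simp [B, norm_smul]
      _ ≤ E ^ 2 * (‖A'‖ * (‖R 0‖ * (‖R 0‖ * (‖R E‖ * ‖S.A‖)))) := by
          gcongr
          refine (norm_mul_le _ _).trans ?_
          gcongr
          refine (norm_mul_le _ _).trans ?_
          gcongr
          refine (norm_mul_le _ _).trans ?_
          gcongr
          exact norm_mul_le _ _
      _ ≤ β' ^ 2 * (‖S.T‖ * (β⁻¹ * (β⁻¹ * (β⁻¹ * ‖S.T‖)))) := by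
          gcongr
      _ = _ := by field_simp
  have hQB : ‖Q * B‖ < 1 := by
    refine lt_of_le_of_lt (norm_mul_le _ _) ?_
    rcases (norm_nonneg Q).eq_or_lt with h0 | h0
    · rw [← h0]; simp
    · exact lt_of_lt_of_le (mul_lt_mul_of_pos_left hBn h0) hQn
  have hPA' : S.P * A' = A' := S.P_adjA
  obtain ⟨K, hPK, hKP, hKF, hFK⟩ := corner_perturb (P := S.P) (F := S.Fesh R E) (Q := Q) (B := B)
    (by simp only [Q, ← mul_assoc, hPP]) (by simp only [Q, mul_assoc, hPP]) (S.Fesh_P R E)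
    (by simp only [B, mul_smul_comm, ← mul_assoc, hPA'])
    (by simp only [B, smul_mul_assoc, mul_assoc, S.A_P])
    (S.inv_Fesh hR hEI hRh) (S.Fesh_inv hR hEI hRh) hQB
  -- the dressed operator
  have hres : R E = R 0 + (E : ℂ) • (R 0 * R E) := by
    ext y; exact S.red_resolvent hR hEI y
  have hres2 : R E = R 0 + (E : ℂ) • (R 0 * R 0) + ((E : ℂ) ^ 2) • (R 0 * (R 0 * R E)) := by
    conv_lhs => rw [hres, hres]
    simp only [mul_add, mul_smul_comm, smul_add, smul_smul, sq, add_assoc]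
  have hFB : S.Fesh R E + B
      = S.P * S.T - A' * (R 0 * S.A) - (E : ℂ) • S.Y R := by
    have hY : S.Y R = S.P + A' * (R 0 * (R 0 * S.A)) := rfl
    have hF : S.Fesh R E = S.P * S.T - (E : ℂ) • S.P - A' * (R E * S.A) := rfl
    rw [hY, hF]
    nth_rewrite 1 [hres2]
    simp only [B, add_mul, mul_add, smul_mul_assoc, mul_smul_comm, smul_add, mul_assoc]
    abel
  obtain ⟨hG1, -, -, hG2⟩ := hG
  replace hG1 : S.P * (G * S.P) = G := hG1
  replace hG2 : G * (S.Y R * G) = S.P := hG2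
  have hPG : S.P * G = G := by
    rw [← hG1, ← mul_assoc, hPP]
  have hGP : G * S.P = G := by
    rw [← hG1]; simp only [mul_assoc, hPP]
  have hY : S.Y R = S.P + A' * (R 0 * (R 0 * S.A)) := rfl
  have hPY : S.P * S.Y R = S.Y R := by
    rw [hY, mul_add, hPP, ← mul_assoc, hPA']
  have hYP : S.Y R * S.P = S.Y R := by
    rw [hY, add_mul, hPP]; simp only [mul_assoc, S.A_P]
  set Y := S.Y R with hYdef
  have hcomm : G * Y = Y * G := by
    calc G * Y = G * (Y * S.P) := by rw [hYP]
      _ = G * (Y * (G * (Y * G))) := by rw [hG2]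
      _ = (G * (Y * G)) * (Y * G) := by simp only [mul_assoc]
      _ = Y * G := by rw [hG2, ← mul_assoc, hPY]
  have hYGG : Y * (G * G) = S.P := by
    rw [← mul_assoc, ← hcomm, mul_assoc, hG2]
  have hW : S.Htilde R G - (E : ℂ) • S.P = G * ((S.Fesh R E + B) * G) := by
    have hH : S.Htilde R G = G * ((S.P * S.T - A' * (R 0 * S.A)) * G) := rfl
    rw [hFB, hH, ← hG2]
    simp only [sub_mul, mul_sub, smul_mul_assoc, mul_smul_comm]
  rw [hW]
  generalize S.Fesh R E + B = L at hKF hFK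
  refine ⟨Y * (G * (K * (Y * G))), ?_, ?_, ?_⟩
  · change S.P * ((Y * (G * (K * (Y * G)))) * S.P) = _
    simp only [mul_assoc, hGP]
    rw [← mul_assoc, hPY]
  · change (Y * (G * (K * (Y * G)))) * (G * (L * G)) = S.P
    calc _ = Y * (G * (K * ((Y * (G * G)) * (L * G)))) := by simp only [mul_assoc]
      _ = Y * (G * ((K * S.P) * L * G)) := by rw [hYGG]; simp only [mul_assoc]
      _ = S.P := by rw [hKP, hKF, hPG, hYGG]
  · change (G * (L * G)) * (Y * (G * (K * (Y * G)))) = S.P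
    calc _ = G * (L * ((G * (Y * G)) * (K * (Y * G)))) := by simp only [mul_assoc]
      _ = G * (L * ((S.P * K) * (Y * G))) := by rw [hG2]; simp only [mul_assoc]
      _ = G * ((L * K) * (Y * G)) := by rw [hPK]; simp only [mul_assoc]
      _ = S.P := by rw [hFK, ← mul_assoc S.P, hPY, hG2]
end
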